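/- For every rational number p ∈ [0,1], the hypograph of the matrix power function X^p admits a free semidefinite representation: there exist positive integers ℓ and g′ and real symmetric ℓ×ℓ matrices A₀, A₁, A₂, B₁, …, B_{g′} (independent of n) such that for every n ≥ 1 and all real symmetric n×n matrices X, Y with X ⪰ 0, one has X^p ⪰ Y ⪰ 0 if and only if there exist real symmetric n×n matrices W₁, …, W_{g′} with A₀ ⊗ I_n + A₁ ⊗ X + A₂ ⊗ Y + Σ_{j=1}^{g′} B_j ⊗ W_j positive semidefinite. -/

import Mathlib

open Matrix

/-- The power `X^p` of a real symmetric matrix, defined via the spectral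
decomposition (powers of the eigenvalues). -/
noncomputable def symPow {n : ℕ} (X : Matrix (Fin n) (Fin n) ℝ) (p : ℝ) :
    Matrix (Fin n) (Fin n) ℝ :=
  if hX : X.IsHermitian then
    (hX.eigenvectorUnitary : Matrix (Fin n) (Fin n) ℝ) *
      Matrix.diagonal (fun i => hX.eigenvalues i ^ p) *
      (star (hX.eigenvectorUnitary : Matrix (Fin n) (Fin n) ℝ))
  else 0

/-- A spectral decomposition of a real symmetric matrix in terms of plain products. -/
lemma Matrix.IsHermitian.eq_mul_diagonal_mul {n : Type*} [Fintype n] [DecidableEq n]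
    {A : Matrix n n ℝ} (hA : A.IsHermitian) :
    A = (hA.eigenvectorUnitary : Matrix n n ℝ) * diagonal hA.eigenvalues *
      star (hA.eigenvectorUnitary : Matrix n n ℝ) := by
  conv_lhs => rw [hA.spectral_theorem, Unitary.conjStarAlgAut_apply]
  rfl

/-- The largest eigenvalue of a real symmetric matrix. -/
lemma Matrix.IsHermitian.exists_max_eigenvector {n : Type*} [Fintype n] [DecidableEq n]
    [Nonempty n] {V : Matrix n n ℝ} (hV : V.IsHermitian) :
    ∃ (c : ℝ) (v : n → ℝ), v ≠ 0 ∧ V *ᵥ v = c • v ∧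
      (c • (1 : Matrix n n ℝ) - V).PosSemidef := by
  obtain ⟨i, hi⟩ := Finite.exists_max hV.eigenvalues
  refine ⟨hV.eigenvalues i, hV.eigenvectorBasis i,
    (WithLp.ofLp_eq_zero 2).ne.2 <| hV.eigenvectorBasis.orthonormal.ne_zero i,
    hV.mulVec_eigenvectorBasis i, ?_⟩
  set U : Matrix n n ℝ := (hV.eigenvectorUnitary : Matrix n n ℝ)
  have hU : U * star U = 1 := Unitary.coe_mul_star_self _
  have hdiag : (diagonal fun j => hV.eigenvalues i - hV.eigenvalues j).PosSemidef :=
    PosSemidef.diagonal fun j => sub_nonneg.2 (hi j)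
  have key := hdiag.mul_mul_conjTranspose_same U
  convert key using 1
  rw [show (diagonal fun j => hV.eigenvalues i - hV.eigenvalues j) =
    hV.eigenvalues i • (1 : Matrix n n ℝ) - diagonal hV.eigenvalues by
      rw [smul_one_eq_diagonal, diagonal_sub]]
  rw [← star_eq_conjTranspose, mul_sub, sub_mul, mul_smul_comm, smul_mul_assoc, mul_one, hU,
    ← hV.eq_mul_diagonal_mul]

/-- The largest generalized eigenvalue of a real symmetric matrix relative to a positive definite
matrix. -/
lemma Matrix.PosDef.exists_max_generalized_eigenvector {n : Type*} [Fintype n] [DecidableEq n]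
    [Nonempty n] {R W : Matrix n n ℝ} (hR : R.PosDef) (hW : W.IsHermitian) :
    ∃ (c : ℝ) (v : n → ℝ), v ≠ 0 ∧ W *ᵥ v = c • R *ᵥ v ∧ (c • R - W).PosSemidef := by
  obtain ⟨C, hC⟩ : ∃ C : Matrix n n ℝ, R = Cᴴ * C := by
    open scoped MatrixOrder ComplexOrder in
    obtain ⟨C, hC⟩ := CStarAlgebra.nonneg_iff_eq_star_mul_self.1 hR.posSemidef.nonneg
    exact ⟨C, hC⟩
  have hCu : IsUnit C := isUnit_of_mul_isUnit_right (hC ▸ hR.isUnit)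
  have hdet : IsUnit C.det := (isUnit_iff_isUnit_det C).1 hCu
  have h1 : C * C⁻¹ = 1 := mul_nonsing_inv _ hdet
  have h2 : C⁻¹ * C = 1 := nonsing_inv_mul _ hdet
  have h3 : Cᴴ * (C⁻¹)ᴴ = 1 := by rw [← conjTranspose_mul, h2, conjTranspose_one]
  have hVh : ((C⁻¹)ᴴ * W * C⁻¹).IsHermitian := isHermitian_conjTranspose_mul_mul _ hW
  obtain ⟨c, v, hv, hcv, hps⟩ := hVh.exists_max_eigenvector
  refine ⟨c, C⁻¹ *ᵥ v, fun h => hv ?_, ?_, ?_⟩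
  · rw [← one_mulVec v, ← h1, ← mulVec_mulVec, h, mulVec_zero]
  · have := congrArg (fun w => Cᴴ *ᵥ w) hcv
    simp only [mulVec_mulVec, mulVec_smul] at this
    rw [mulVec_mulVec, mulVec_mulVec, hC, mul_assoc, h1, mul_one, ← this]
    rw [← mul_assoc, ← mul_assoc, h3, one_mul]
  · have := hps.conjTranspose_mul_mul_same C
    convert this using 1
    rw [mul_sub, sub_mul, hC, mul_smul_comm, mul_one, smul_mul_assoc]
    congr 1
    rw [← mul_assoc, ← mul_assoc, h3, one_mul, mul_assoc, h2, mul_one]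

/-- A discrete maximum principle for nonnegative log-convex sequences. -/
lemma le_of_sq_le_mul_of_boundary_le {N : ℕ} {a : ℕ → ℝ} {c : ℝ} (ha : ∀ k ≤ N, 0 < a k)
    (h0 : a 0 ≤ c) (hN : a N ≤ c)
    (h : ∀ k, k + 2 ≤ N → a (k + 1) ^ 2 ≤ a k * a (k + 2)) {k : ℕ} (hk : k ≤ N) : a k ≤ c := by
  by_contra! hlt
  obtain ⟨i, hi, hmax⟩ := Finset.exists_max_image (Finset.range (N + 1)) a ⟨0, by simp⟩
  have hex : ∃ j, j ≤ N ∧ ∀ k ≤ N, a k ≤ a j :=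
    ⟨i, by simpa [Nat.lt_succ_iff] using hi, fun k hk => hmax k (by simpa [Nat.lt_succ_iff] using hk)⟩
  classical
  obtain ⟨hjN, hj⟩ := Nat.find_spec hex
  have hmin := fun m => Nat.find_min (m := m) hex
  set j := Nat.find hex
  have hcj : c < a j := hlt.trans_le (hj k hk)
  rcases j with _ | j
  · linarith
  have hne : j + 1 ≠ N := by rintro h; rw [h] at hcj; linarith
  have hstrict : a j < a (j + 1) := by
    refine lt_of_le_of_ne (hj j (by omega)) fun he => hmin j (by omega) ⟨by omega, he ▸ hj⟩
  have h1 := h j (by omega)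
  have h2 := hj (j + 2) (by omega)
  have h3 := ha j (by omega)
  have h4 := ha (j + 1) (by omega)
  nlinarith

/-- The `2 × 2` block Hankel matrix with blocks `Z k, Z (k + 1), Z (k + 1), Z (k + 2)`. -/
def hankelBlock {n : Type*} (Z : ℕ → Matrix n n ℝ) (k : ℕ) :
    Matrix (Fin 2 × n) (Fin 2 × n) ℝ :=
  Matrix.of fun a b => Z (k + a.1 + b.1) a.2 b.2

lemma hankelBlock_dotProduct {n : Type*} [Fintype n] (Z : ℕ → Matrix n n ℝ) (k : ℕ)
    (u : Fin 2 → n → ℝ) :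
    (fun a : Fin 2 × n => u a.1 a.2) ⬝ᵥ
        (hankelBlock Z k *ᵥ fun a : Fin 2 × n => u a.1 a.2) =
      u 0 ⬝ᵥ (Z k *ᵥ u 0) + u 0 ⬝ᵥ (Z (k + 1) *ᵥ u 1) +
        (u 1 ⬝ᵥ (Z (k + 1) *ᵥ u 0) + u 1 ⬝ᵥ (Z (k + 2) *ᵥ u 1)) := by
  simp [dotProduct, mulVec, hankelBlock, Fintype.sum_prod_type, Fin.sum_univ_two,
    mul_add, Finset.sum_add_distrib]
  ring

lemma hankelBlock_pow_posSemidef {n : Type*} [Fintype n] [DecidableEq n] {D : Matrix n n ℝ}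
    (hD : D.PosSemidef) (k : ℕ) : (hankelBlock (fun k => D ^ k) k).PosSemidef := by
  have h := (hD.pow k).conjTranspose_mul_mul_same
    (Matrix.of fun (x : n) (a : Fin 2 × n) => (D ^ (a.1 : ℕ)) x a.2)
  convert h using 1
  ext ⟨i, x⟩ ⟨j, y⟩
  have hsym : ∀ z, (D ^ (i : ℕ)) z x = (D ^ (i : ℕ)) x z := fun z => by
    simpa using (hD.pow (i : ℕ)).isHermitian.apply x z
  have : D ^ (k + i + j : ℕ) = D ^ (i : ℕ) * D ^ k * D ^ (j : ℕ) := by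
    rw [← pow_add, ← pow_add, add_comm k]
  simp [hankelBlock, this, mul_apply, hsym]

/-- If consecutive members of a chain of symmetric matrices are linked by positive semidefinite
block Hankel matrices, then bounds of the end points by powers of `D` propagate to the chain. -/
lemma le_pow_of_hankelBlock_posSemidef {n : Type*} [Fintype n] [DecidableEq n] [Nonempty n]
    {D : Matrix n n ℝ} (hD : D.PosDef) {Z : ℕ → Matrix n n ℝ} (hZ : ∀ k, (Z k).IsHermitian)
    {N : ℕ} (h0 : (1 - Z 0).PosSemidef) (hN : (D ^ N - Z N).PosSemidef)
    (h : ∀ k, k + 2 ≤ N → (hankelBlock Z k).PosSemidef) {k : ℕ} (hk : k ≤ N) :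
    (D ^ k - Z k).PosSemidef := by
  have hpow : ∀ k, (D ^ k).PosDef := fun k =>
    (hD.posSemidef.pow k).posDef_iff_isUnit.2 (hD.isUnit.pow k)
  choose c v hv hcv hc using fun k => (hpow k).exists_max_generalized_eigenvector (hZ k)
  have quad : ∀ {S : Matrix n n ℝ} (_ : S.PosSemidef) (x : n → ℝ), 0 ≤ x ⬝ᵥ (S *ᵥ x) :=
    fun hS x => by simpa using hS.dotProduct_mulVec_nonneg x
  have pos : ∀ k {x : n → ℝ} (_ : x ≠ 0), 0 < x ⬝ᵥ (D ^ k *ᵥ x) :=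
    fun k x hx => by simpa using (hpow k).dotProduct_mulVec_pos hx
  have bdry : ∀ k, (D ^ k - Z k).PosSemidef → c k ≤ 1 := fun k hk => by
    have h1 := quad hk (v k)
    rw [sub_mulVec, hcv, dotProduct_sub, dotProduct_smul, smul_eq_mul] at h1
    have := pos k (hv k)
    by_contra! hlt
    nlinarith
  have hDt : ∀ x y : n → ℝ, (D *ᵥ x) ⬝ᵥ y = x ⬝ᵥ (D *ᵥ y) := fun x y => by
    have : Dᵀ = D := by simpa using hD.isHermitian.eq
    rw [dotProduct_mulVec, ← mulVec_transpose, this]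
  have hlin : ∀ k, k + 2 ≤ N → ∀ a b : ℝ, 
      2 * (a * b) * c (k + 1) ≤ a ^ 2 * c k + b ^ 2 * c (k + 2) := by
    intro k hkN a b
    set y := v (k + 1)
    have h1 := (h k hkN).dotProduct_mulVec_nonneg
      (fun p => (![-(a • (D *ᵥ y)), b • y] : Fin 2 → n → ℝ) p.1 p.2)
    rw [star_trivial, hankelBlock_dotProduct] at h1
    have hA := quad (hc k) (D *ᵥ y)
    have hB := quad (hc (k + 2)) y
    have hT := pos (k + 2) (hv (k + 1))
    have e1 : (D *ᵥ y) ⬝ᵥ (D ^ k *ᵥ (D *ᵥ y)) = y ⬝ᵥ (D ^ (k + 2) *ᵥ y) := by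
      rw [hDt, mulVec_mulVec, mulVec_mulVec, ← pow_succ', ← pow_succ]
    have e2 : (D *ᵥ y) ⬝ᵥ (Z (k + 1) *ᵥ y) = c (k + 1) * y ⬝ᵥ (D ^ (k + 2) *ᵥ y) := by
      rw [hDt, hcv, mulVec_smul, mulVec_mulVec, ← pow_succ', dotProduct_smul, smul_eq_mul]
    have e3 : y ⬝ᵥ (Z (k + 1) *ᵥ (D *ᵥ y)) = (D *ᵥ y) ⬝ᵥ (Z (k + 1) *ᵥ y) := by
      have : (Z (k + 1))ᵀ = Z (k + 1) := by simpa using (hZ (k + 1)).eq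
      rw [dotProduct_mulVec, ← mulVec_transpose, this, dotProduct_comm]
    simp only [sub_mulVec, smul_mulVec, dotProduct_sub, dotProduct_smul, smul_eq_mul, e1] at hA hB
    simp only [Matrix.cons_val_zero, Matrix.cons_val_one, mulVec_neg, mulVec_smul, dotProduct_neg,
      neg_dotProduct, dotProduct_smul, smul_dotProduct, smul_eq_mul, e3, e2] at h1
    have hA' := mul_le_mul_of_nonneg_left (sub_nonneg.1 hA) (sq_nonneg a)
    have hB' := mul_le_mul_of_nonneg_left (sub_nonneg.1 hB) (sq_nonneg b)
    refine le_of_mul_le_mul_right ?_ hT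
    change _ * (y ⬝ᵥ (D ^ (k + 2) *ᵥ y)) ≤ _ * (y ⬝ᵥ (D ^ (k + 2) *ᵥ y))
    linarith
  have hmax : max (c k) 1 ≤ 1 := by
    refine le_of_sq_le_mul_of_boundary_le (N := N) (a := fun k => max (c k) 1)
      (fun k _ => by positivity) (max_le (bdry 0 (by simpa using h0)) le_rfl)
      (max_le (bdry N hN) le_rfl) (fun k hkN => ?_) hk
    set s := max (c k) 1
    set t := max (c (k + 2)) 1
    have hs : 1 ≤ s := le_max_right _ _
    have ht : 1 ≤ t := le_max_right _ _
    have h1 := hlin k hkN (√t) (√s)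
    have hst : √t * √s = √(s * t) := by rw [mul_comm, Real.sqrt_mul (by positivity)]
    rw [Real.sq_sqrt (by positivity), Real.sq_sqrt (by positivity), hst] at h1
    have hpos : 0 < √(s * t) := by positivity
    have hsq : √(s * t) ^ 2 = s * t := Real.sq_sqrt (by positivity)
    have hck : c k ≤ s := le_max_left _ _
    have hck2 : c (k + 2) ≤ t := le_max_left _ _
    have h2 : c (k + 1) ≤ √(s * t) := by
      by_contra! hlt
      nlinarith
    have h3 : 1 ≤ √(s * t) := by
      rw [Real.one_le_sqrt]; nlinarith
    rw [← hsq]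
    exact pow_le_pow_left₀ (by positivity) (max_le h2 h3) 2
  have hck : 0 ≤ 1 - c k := sub_nonneg.2 ((le_max_left _ _).trans hmax)
  have := (hc k).add ((hpow k).posSemidef.smul hck)
  convert this using 1
  module

/-- The positive semidefinite version of `le_pow_of_hankelBlock_posSemidef`. -/
lemma le_pow_of_hankelBlock_posSemidef' {n : Type*} [Fintype n] [DecidableEq n] [Nonempty n]
    {D : Matrix n n ℝ} (hD : D.PosSemidef) {Z : ℕ → Matrix n n ℝ} (hZ : ∀ k, (Z k).IsHermitian)
    {N : ℕ} (h0 : (1 - Z 0).PosSemidef) (hN : (D ^ N - Z N).PosSemidef)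
    (h : ∀ k, k + 2 ≤ N → (hankelBlock Z k).PosSemidef) {k : ℕ} (hk : k ≤ N) :
    (D ^ k - Z k).PosSemidef := by
  have hmono : ∀ ε : ℝ, 0 < ε → ((D + ε • 1) ^ N - D ^ N).PosSemidef := by
    intro ε hε
    have hcomm : Commute D (ε • (1 : Matrix n n ℝ)) := (Commute.one_right D).smul_right ε
    rw [hcomm.add_pow, Finset.sum_range_succ]
    simp only [Nat.sub_self, pow_zero, mul_one, Nat.choose_self, Nat.cast_one, add_sub_cancel_right]
    refine posSemidef_sum _ fun i _ => ?_
    rw [smul_pow, one_pow, mul_smul_comm, mul_one, ← nsmul_eq_mul', ← Nat.cast_smul_eq_nsmul ℝ]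
    exact ((hD.pow i).smul (by positivity)).smul (by positivity)
  have hε : ∀ ε : ℝ, 0 < ε → ((D + ε • 1) ^ k - Z k).PosSemidef := by
    intro ε hε
    have hpd : (D + ε • (1 : Matrix n n ℝ)).PosDef :=
      PosDef.posSemidef_add hD (PosDef.one.smul hε)
    refine le_pow_of_hankelBlock_posSemidef hpd hZ h0 ?_ h hk
    simpa using (hmono ε hε).add hN
  refine posSemidef_iff_dotProduct_mulVec.2 ⟨(hD.pow k).isHermitian.sub (hZ k), fun x => ?_⟩
  have hcont : Continuous fun ε : ℝ => star x ⬝ᵥ (((D + ε • 1) ^ k - Z k) *ᵥ x) := by fun_prop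
  have hlim := (hcont.tendsto 0).mono_left (nhdsWithin_le_nhds (s := Set.Ioi 0))
  simp only [zero_smul, add_zero] at hlim
  refine ge_of_tendsto hlim ?_
  filter_upwards [self_mem_nhdsWithin] with ε hpos
  exact (hε ε hpos).dotProduct_mulVec_nonneg x

lemma symPow_eq {n : ℕ} {X : Matrix (Fin n) (Fin n) ℝ} (hX : X.IsHermitian) (p : ℝ) :
    symPow X p = (hX.eigenvectorUnitary : Matrix (Fin n) (Fin n) ℝ) *
      diagonal (fun i => hX.eigenvalues i ^ p) *
      star (hX.eigenvectorUnitary : Matrix (Fin n) (Fin n) ℝ) :=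
  dif_pos hX

lemma symPow_one {n : ℕ} {X : Matrix (Fin n) (Fin n) ℝ} (hX : X.IsHermitian) :
    symPow X 1 = X := by
  conv_rhs => rw [hX.eq_mul_diagonal_mul]
  simp only [symPow_eq hX, Real.rpow_one]

lemma symPow_posSemidef {n : ℕ} {X : Matrix (Fin n) (Fin n) ℝ} (hX : X.PosSemidef) (p : ℝ) :
    (symPow X p).PosSemidef := by
  rw [symPow_eq hX.isHermitian]
  exact (PosSemidef.diagonal fun i =>
    Real.rpow_nonneg (hX.eigenvalues_nonneg i) p).mul_mul_conjTranspose_same _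

lemma symPow_pow {n : ℕ} {X : Matrix (Fin n) (Fin n) ℝ} (hX : X.PosSemidef) (p : ℝ) (k : ℕ) :
    symPow X p ^ k = symPow X (p * k) := by
  have hU := Unitary.coe_star_mul_self hX.isHermitian.eigenvectorUnitary
  simp only [symPow_eq hX.isHermitian, Real.rpow_mul_natCast (hX.eigenvalues_nonneg _)]
  induction k with
  | zero => simp
  | succ k ih =>
    rw [pow_succ, ih]
    simp only [mul_assoc]
    rw [← mul_assoc (star _) (_ : Matrix (Fin n) (Fin n) ℝ), hU, one_mul,
      ← mul_assoc (diagonal _), diagonal_mul_diagonal]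
    simp only [pow_succ]

lemma Matrix.posSemidef_blockDiagonal_iff {m o : Type*} [Fintype m] [Fintype o] [DecidableEq o]
    {M : o → Matrix m m ℝ} : (blockDiagonal M).PosSemidef ↔ ∀ k, (M k).PosSemidef := by
  constructor
  · intro h k
    convert h.submatrix (fun i => (i, k)) using 1
    ext i j
    simp [blockDiagonal_apply]
  · intro h
    refine posSemidef_iff_dotProduct_mulVec.2 ⟨?_, fun x => ?_⟩
    · rw [IsHermitian, blockDiagonal_conjTranspose]
      exact congrArg _ (funext fun k => (h k).isHermitian)
    · have : star x ⬝ᵥ (blockDiagonal M *ᵥ x) =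
          ∑ k, star (fun i => x (i, k)) ⬝ᵥ (M k *ᵥ fun i => x (i, k)) := by
        simp [dotProduct, mulVec, blockDiagonal_apply, Fintype.sum_prod_type_right, ite_mul]
      rw [this]
      exact Finset.sum_nonneg fun k _ => (h k).dotProduct_mulVec_nonneg _

open Kronecker in
lemma Matrix.posSemidef_one_kronecker_iff {ι n : Type*} [Fintype ι] [DecidableEq ι] [Nonempty ι]
    [Fintype n] {S : Matrix n n ℝ} : ((1 : Matrix ι ι ℝ) ⊗ₖ S).PosSemidef ↔ S.PosSemidef := by
  refine ⟨fun h => ?_, fun h => PosSemidef.one.kronecker h⟩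
  convert h.submatrix (fun i => (Classical.arbitrary ι, i)) using 1
  ext i j
  simp

open Kronecker in
/-- A finite family of linear pencils of the same size can be merged into a single linear pencil,
whose positivity is the simultaneous positivity of all members of the family. -/
lemma exists_pencil_posSemidef_iff_forall {m o γ : Type*} [Fintype m] [Fintype o] [DecidableEq o]
    [Fintype γ] (a₀ a₁ a₂ : o → Matrix m m ℝ) (b : γ → o → Matrix m m ℝ)
    (h₀ : ∀ k, (a₀ k).IsHermitian) (h₁ : ∀ k, (a₁ k).IsHermitian) (h₂ : ∀ k, (a₂ k).IsHermitian)
    (hb : ∀ j k, (b j k).IsHermitian) :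
    ∃ (A₀ A₁ A₂ : Matrix (Fin (Fintype.card (m × o))) (Fin (Fintype.card (m × o))) ℝ)
      (B : γ → Matrix (Fin (Fintype.card (m × o))) (Fin (Fintype.card (m × o))) ℝ),
      A₀.IsHermitian ∧ A₁.IsHermitian ∧ A₂.IsHermitian ∧ (∀ j, (B j).IsHermitian) ∧
      ∀ (n : ℕ) (X Y : Matrix (Fin n) (Fin n) ℝ) (W : γ → Matrix (Fin n) (Fin n) ℝ),
        (A₀ ⊗ₖ (1 : Matrix (Fin n) (Fin n) ℝ) + A₁ ⊗ₖ X + A₂ ⊗ₖ Y + ∑ j, B j ⊗ₖ W j).PosSemidef ↔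
        ∀ k, (a₀ k ⊗ₖ (1 : Matrix (Fin n) (Fin n) ℝ) + a₁ k ⊗ₖ X + a₂ k ⊗ₖ Y
          + ∑ j, b j k ⊗ₖ W j).PosSemidef := by
  have hblock : ∀ a : o → Matrix m m ℝ, (∀ k, (a k).IsHermitian) →
      (blockDiagonal a).IsHermitian := fun a ha => by
    rw [IsHermitian, blockDiagonal_conjTranspose]
    exact congrArg _ (funext fun k => ha k)
  let e := (Fintype.equivFin (m × o)).symm
  refine ⟨(blockDiagonal a₀).submatrix e e, (blockDiagonal a₁).submatrix e e,
    (blockDiagonal a₂).submatrix e e, fun j => (blockDiagonal (b j)).submatrix e e,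
    (hblock _ h₀).submatrix _, (hblock _ h₁).submatrix _, (hblock _ h₂).submatrix _,
    fun j => (hblock _ (hb j)).submatrix _, fun n X Y W => ?_⟩
  let f : Fin (Fintype.card (m × o)) × Fin n ≃ (m × Fin n) × o :=
    { toFun := fun q => (((e q.1).1, q.2), (e q.1).2)
      invFun := fun q => (e.symm (q.1.1, q.2), q.1.2)
      left_inv := fun q => by simp
      right_inv := fun q => by simp }
  rw [← posSemidef_blockDiagonal_iff, ← posSemidef_submatrix_equiv f]
  refine iff_of_eq (congrArg _ ?_)
  ext ⟨i, x⟩ ⟨j, y⟩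
  by_cases h : (e i).2 = (e j).2 <;>
    simp [f, blockDiagonal_apply, Matrix.sum_apply, h]

open Kronecker in
/-- For every rational `p ∈ [0,1]`, the hypograph of `X^p` has a free
semidefinite representation: there are fixed real symmetric `ℓ × ℓ` matrices
`A₀, A₁, A₂, B₁, …, B_{g'}` (independent of `n`) such that for all `n ≥ 1`
and real symmetric `X ⪰ 0`, `Y`:  `X^p ⪰ Y ⪰ 0` iff there are real
symmetric `n × n` matrices `W₁, …, W_{g'}` making the linear pencil
`A₀ ⊗ I + A₁ ⊗ X + A₂ ⊗ Y + ∑ⱼ Bⱼ ⊗ Wⱼ` positive semidefinite. -/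
theorem power_hypograph_free_sdr (p : ℚ) (hp0 : 0 ≤ p) (hp1 : p ≤ 1) :
    ∃ (l g' : ℕ), 1 ≤ l ∧ 1 ≤ g' ∧
    ∃ (A₀ A₁ A₂ : Matrix (Fin l) (Fin l) ℝ) (B : Fin g' → Matrix (Fin l) (Fin l) ℝ),
      A₀.IsHermitian ∧ A₁.IsHermitian ∧ A₂.IsHermitian ∧
      (∀ j, (B j).IsHermitian) ∧
      ∀ (n : ℕ), 1 ≤ n →
        ∀ (X Y : Matrix (Fin n) (Fin n) ℝ), X.PosSemidef → Y.IsHermitian →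
          (((symPow X (p : ℝ) - Y).PosSemidef ∧ Y.PosSemidef)
            ↔
          (∃ W : Fin g' → Matrix (Fin n) (Fin n) ℝ,
            (∀ j, (W j).IsHermitian) ∧
            (A₀ ⊗ₖ (1 : Matrix (Fin n) (Fin n) ℝ) + A₁ ⊗ₖ X + A₂ ⊗ₖ Y
              + ∑ j, B j ⊗ₖ W j).PosSemidef)) := by
  set N := p.den
  set m := p.num.toNat
  have hNpos : 0 < N := p.den_pos
  have hnum : ((m : ℕ) : ℤ) = p.num := Int.toNat_of_nonneg (Rat.num_nonneg.2 hp0)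
  have hmN : m ≤ N := by
    have : p.num ≤ p.den := by simpa using Rat.num_le_denom_iff.2 hp1
    omega
  have hpR : (p : ℝ) = (1 / N : ℝ) * m := by
    rw [Rat.cast_def, ← hnum]
    push_cast
    ring
  let a₀ : Fin 4 ⊕ Fin (N - 1) → Matrix (Fin 2) (Fin 2) ℝ := Sum.elim ![0, 0, 1, 0] 0
  let a₁ : Fin 4 ⊕ Fin (N - 1) → Matrix (Fin 2) (Fin 2) ℝ := Sum.elim ![0, 0, 0, 1] 0
  let a₂ : Fin 4 ⊕ Fin (N - 1) → Matrix (Fin 2) (Fin 2) ℝ := Sum.elim ![1, -1, 0, 0] 0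
  let b : Fin (N + 1) → Fin 4 ⊕ Fin (N - 1) → Matrix (Fin 2) (Fin 2) ℝ := fun j =>
    Sum.elim ![0, (if j = Fin.ofNat (N + 1) m then 1 else 0 : ℝ) • 1,
        (if j = Fin.ofNat (N + 1) 0 then -1 else 0 : ℝ) • 1,
        (if j = Fin.ofNat (N + 1) N then -1 else 0 : ℝ) • 1]
      fun k => Matrix.of fun r s => if j = Fin.ofNat (N + 1) (k + r + s) then 1 else 0
  obtain ⟨A₀, A₁, A₂, B, hA₀, hA₁, hA₂, hB, H⟩ := exists_pencil_posSemidef_iff_forall a₀ a₁ a₂ b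
    (by rintro (k | k) <;> [fin_cases k; skip] <;> simp [a₀])
    (by rintro (k | k) <;> [fin_cases k; skip] <;> simp [a₁])
    (by rintro (k | k) <;> [fin_cases k; skip] <;> simp [a₂, IsHermitian])
    (by
      rintro j (k | k)
      · fin_cases k <;> simp only [b, IsHermitian] <;> simp <;> split_ifs <;> simp
      · ext r s
        simp [b, add_right_comm])
  refine ⟨_, N + 1, ?_, Nat.le_add_left _ _, A₀, A₁, A₂, B, hA₀, hA₁, hA₂, hB, ?_⟩
  · exact Fintype.card_pos
  intro n hn X Y hX hY
  have : Nonempty (Fin n) := ⟨⟨0, hn⟩⟩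
  have key : ∀ W : Fin (N + 1) → Matrix (Fin n) (Fin n) ℝ,
      (A₀ ⊗ₖ (1 : Matrix (Fin n) (Fin n) ℝ) + A₁ ⊗ₖ X + A₂ ⊗ₖ Y + ∑ j, B j ⊗ₖ W j).PosSemidef ↔
      (Y.PosSemidef ∧ (W (Fin.ofNat (N + 1) m) - Y).PosSemidef ∧
        (1 - W (Fin.ofNat (N + 1) 0)).PosSemidef ∧ (X - W (Fin.ofNat (N + 1) N)).PosSemidef) ∧
        ∀ k, k + 2 ≤ N → (hankelBlock (fun k => W (Fin.ofNat (N + 1) k)) k).PosSemidef := by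
    intro W
    have hk : ∀ k : Fin (N - 1), a₀ (.inr k) ⊗ₖ (1 : Matrix (Fin n) (Fin n) ℝ) +
        a₁ (.inr k) ⊗ₖ X + a₂ (.inr k) ⊗ₖ Y + ∑ j, b j (.inr k) ⊗ₖ W j =
        hankelBlock (fun k => W (Fin.ofNat (N + 1) k)) k := fun k => by
      ext ⟨r, x⟩ ⟨s, y⟩
      simp [a₀, a₁, a₂, b, hankelBlock, Matrix.sum_apply]
    have hsingle : ∀ (c : ℝ) (i : Fin (N + 1)),
        ∑ j, ((if j = i then c else 0) • (1 : Matrix (Fin 2) (Fin 2) ℝ)) ⊗ₖ W j =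
        c • ((1 : Matrix (Fin 2) (Fin 2) ℝ) ⊗ₖ W i) := fun c i => by
      simp only [smul_kronecker]
      simp
    have hsub : ∀ S T : Matrix (Fin n) (Fin n) ℝ, (1 : Matrix (Fin 2) (Fin 2) ℝ) ⊗ₖ (S - T) =
        (1 : Matrix (Fin 2) (Fin 2) ℝ) ⊗ₖ S - (1 : Matrix (Fin 2) (Fin 2) ℝ) ⊗ₖ T := fun S T => by
      ext
      simp [mul_sub]
    have hneg : (-1 : Matrix (Fin 2) (Fin 2) ℝ) ⊗ₖ Y = -((1 : Matrix (Fin 2) (Fin 2) ℝ) ⊗ₖ Y) := by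
      ext
      simp
    have h0 : a₀ (.inl 0) ⊗ₖ (1 : Matrix (Fin n) (Fin n) ℝ) +
        a₁ (.inl 0) ⊗ₖ X + a₂ (.inl 0) ⊗ₖ Y + ∑ j, b j (.inl 0) ⊗ₖ W j =
        (1 : Matrix (Fin 2) (Fin 2) ℝ) ⊗ₖ Y := by
      simp [a₀, a₁, a₂, b]
    have h1 : a₀ (.inl 1) ⊗ₖ (1 : Matrix (Fin n) (Fin n) ℝ) +
        a₁ (.inl 1) ⊗ₖ X + a₂ (.inl 1) ⊗ₖ Y + ∑ j, b j (.inl 1) ⊗ₖ W j =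
        (1 : Matrix (Fin 2) (Fin 2) ℝ) ⊗ₖ (W (Fin.ofNat (N + 1) m) - Y) := by
      rw [show ∑ j, b j (.inl 1) ⊗ₖ W j = _ from hsingle 1 _, hsub]
      simp [a₀, a₁, a₂, hneg, sub_eq_add_neg, add_comm]
    have h2 : a₀ (.inl 2) ⊗ₖ (1 : Matrix (Fin n) (Fin n) ℝ) +
        a₁ (.inl 2) ⊗ₖ X + a₂ (.inl 2) ⊗ₖ Y + ∑ j, b j (.inl 2) ⊗ₖ W j =
        (1 : Matrix (Fin 2) (Fin 2) ℝ) ⊗ₖ (1 - W (Fin.ofNat (N + 1) 0)) := by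
      rw [show ∑ j, b j (.inl 2) ⊗ₖ W j = _ from hsingle (-1) _, hsub]
      simp [a₀, a₁, a₂, sub_eq_add_neg, add_comm]
    have h3 : a₀ (.inl 3) ⊗ₖ (1 : Matrix (Fin n) (Fin n) ℝ) +
        a₁ (.inl 3) ⊗ₖ X + a₂ (.inl 3) ⊗ₖ Y + ∑ j, b j (.inl 3) ⊗ₖ W j =
        (1 : Matrix (Fin 2) (Fin 2) ℝ) ⊗ₖ (X - W (Fin.ofNat (N + 1) N)) := by
      rw [show ∑ j, b j (.inl 3) ⊗ₖ W j = _ from hsingle (-1) _, hsub]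
      simp [a₀, a₁, a₂, sub_eq_add_neg, add_comm]
    rw [H n X Y W, Sum.forall]
    simp only [Fin.forall_fin_succ, Fin.forall_fin_zero, and_true, hk]
    refine and_congr ?_ ⟨fun h k hk => h ⟨k, by omega⟩, fun h k => h k (by omega)⟩
    refine and_congr ?_ (and_congr ?_ (and_congr ?_ ?_))
    · rw [h0, posSemidef_one_kronecker_iff]
    · exact h1 ▸ posSemidef_one_kronecker_iff
    · exact h2 ▸ posSemidef_one_kronecker_iff
    · exact h3 ▸ posSemidef_one_kronecker_iff
  set D := symPow X (1 / N : ℝ)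
  have hD : D.PosSemidef := symPow_posSemidef hX _
  have hDm : symPow X (p : ℝ) = D ^ m := by rw [hpR, symPow_pow hX]
  have hDN : X = D ^ N := by
    rw [symPow_pow hX, one_div_mul_cancel (by positivity), symPow_one hX.isHermitian]
  simp only [key, hDm]
  have hval : ∀ k ≤ N, (Fin.ofNat (N + 1) k : ℕ) = k := fun k hk =>
    Nat.mod_eq_of_lt (Nat.lt_succ_of_le hk)
  constructor
  · rintro ⟨hYD, hYpos⟩
    refine ⟨fun j => D ^ (j : ℕ), fun j => (hD.pow _).isHermitian,
      ⟨hYpos, ?_, ?_, ?_⟩, fun k hk => ?_⟩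
    · simpa only [hval m hmN] using hYD
    · simpa using PosSemidef.zero
    · simpa only [hval N le_rfl, ← hDN, sub_self] using PosSemidef.zero
    · convert hankelBlock_pow_posSemidef hD k using 1
      ext ⟨r, x⟩ ⟨s, y⟩
      simp only [hankelBlock, of_apply]
      rw [hval _ (by have := r.2; have := s.2; omega)]
  · rintro ⟨W, hW, ⟨hYpos, hYW, h0, hXW⟩, hH⟩
    refine ⟨?_, hYpos⟩
    have := le_pow_of_hankelBlock_posSemidef' hD
      (Z := fun k => W (Fin.ofNat (N + 1) k)) (fun k => hW _) h0 (hDN ▸ hXW) hH hmN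
    simpa using this.add hYW
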